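/- Consider length-6 words w = w₁w₂⋯w₆ in the alphabet {S, C, L, R}, where S, C, L, R are interpreted in PSL(2,ℤ) = ⟨x, y : x² = y³ = 1⟩ as S = yxy, C = xyxyx, L = xy², R = y²x. Call two such words equivalent if one can be obtained from the other by a cyclic rotation, or by reversing the order of letters while simultaneously exchanging every L with R and every R with L (and then possibly a cyclic rotation). Then the number of equivalence classes of length-6 words whose product equals the identity in PSL(2,ℤ) is exactly 25. -/

import Mathlib

inductive Stone : Type
  | C | S | R | L
deriving DecidableEq

/-- stone monodromies as words in x, y (integer matrices): S = yxy, C = xyxyx,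
R = y²x, L = xy². -/
def stoneMat : Stone → Matrix (Fin 2) (Fin 2) ℤ
  | .S => !![0,1;-1,1] * !![0,1;-1,0] * !![0,1;-1,1]
  | .C => !![0,1;-1,0] * !![0,1;-1,1] * !![0,1;-1,0] * !![0,1;-1,1] * !![0,1;-1,0]
  | .R => !![0,1;-1,1] ^ 2 * !![0,1;-1,0]
  | .L => !![0,1;-1,0] * !![0,1;-1,1] ^ 2

/-- the exchange L ↔ R (fixing S and C). -/
def swapLR : Stone → Stone
  | .R => .L
  | .L => .R
  | .S => .S
  | .C => .C

/-- order-reversal combined with the exchange L ↔ R. -/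
def revSwap (l : List Stone) : List Stone := (l.map swapLR).reverse

/-- equivalence of words: cyclic rotation, possibly combined with
order-reversal and the exchange L ↔ R. -/
def wordEquiv (u v : List Stone) : Prop :=
  ∃ k, v = u.rotate k ∨ v = (revSwap u).rotate k

/-- the word has identity monodromy in PSL(2,ℤ), i.e. its product is ±I. -/
def idMonodromy (l : List Stone) : Prop :=
  (l.map stoneMat).prod = 1 ∨ (l.map stoneMat).prod = -1

instance : Fintype Stone :=
  ⟨{.C, .S, .R, .L}, fun x => by cases x <;> decide⟩

/-- Entries `(a, b, c, d)` of the monodromy matrix `!![a, b; c, d]` of a word, in a form suited to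
kernel computation. -/
def monodromyEntries : List Stone → ℤ × ℤ × ℤ × ℤ
  | [] => (1, 0, 0, 1)
  | s :: l =>
    match s, monodromyEntries l with
    | .S, (a, b, c, d) => (-c, -d, a - 2 * c, b - 2 * d)
    | .C, (a, b, c, d) => (2 * a + c, 2 * b + d, -a, -b)
    | .R, (a, b, c, d) => (-a - c, -b - d, -c, -d)
    | .L, (a, b, c, d) => (-a, -b, a - c, b - d)

theorem prod_map_stoneMat (l : List Stone) :
    (l.map stoneMat).prod =
      !![(monodromyEntries l).1, (monodromyEntries l).2.1;
        (monodromyEntries l).2.2.1, (monodromyEntries l).2.2.2] := by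
  induction l with
  | nil => simp [monodromyEntries, Matrix.one_fin_two]
  | cons s l ih =>
    rw [List.map_cons, List.prod_cons, ih]
    cases s <;> ext i j <;> fin_cases i <;> fin_cases j <;>
      simp [monodromyEntries, stoneMat, Matrix.mul_apply, Fin.sum_univ_two, pow_two] <;> ring

theorem idMonodromy_iff (l : List Stone) :
    idMonodromy l ↔
      monodromyEntries l = (1, 0, 0, 1) ∨ monodromyEntries l = (-1, 0, 0, -1) := by
  rw [idMonodromy, prod_map_stoneMat, Matrix.one_fin_two]
  simp [Prod.ext_iff, and_assoc]

instance : DecidablePred idMonodromy := fun l => decidable_of_iff _ (idMonodromy_iff l).symm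

theorem wordEquiv_iff (u v : List Stone) : wordEquiv u v ↔ u ~r v ∨ revSwap u ~r v := by
  simp only [wordEquiv, List.IsRotated, exists_or, eq_comm]

instance : DecidableRel wordEquiv := fun u v => decidable_of_iff _ (wordEquiv_iff u v).symm

theorem revSwap_revSwap (l : List Stone) : revSwap (revSwap l) = l := by
  have h : swapLR ∘ swapLR = id := by funext s; cases s <;> rfl
  simp [revSwap, h]

theorem List.IsRotated.revSwap {u v : List Stone} (h : u ~r v) :
    _root_.revSwap u ~r _root_.revSwap v :=
  (h.map swapLR).reverse

theorem wordEquiv_equivalence : Equivalence wordEquiv where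
  refl u := (wordEquiv_iff u u).2 (.inl (.refl u))
  symm {u v} h := by
    rw [wordEquiv_iff] at h ⊢
    refine h.imp List.IsRotated.symm fun h => ?_
    simpa [revSwap_revSwap] using h.symm.revSwap
  trans {u v w} huv hvw := by
    rw [wordEquiv_iff] at huv hvw ⊢
    rcases huv with huv | huv <;> rcases hvw with hvw | hvw
    · exact .inl (huv.trans hvw)
    · exact .inr (huv.revSwap.trans hvw)
    · exact .inr (huv.trans hvw)
    · exact .inl (by simpa [revSwap_revSwap] using huv.revSwap.trans hvw)

open Stone in
/-- One word from each equivalence class of 6-stone words with identity monodromy. -/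
def classReps : List (List Stone) :=
  [[C, C, C, L, C, R], [C, C, L, C, C, L], [C, C, L, C, L, R], [C, C, L, L, R, R],
   [C, L, C, L, C, L], [C, L, C, L, L, R], [C, L, L, C, L, L], [C, L, L, L, L, S],
   [C, L, L, L, R, L], [C, L, L, L, S, R], [C, L, L, R, L, R], [C, L, L, S, R, R],
   [C, L, R, C, L, R], [L, L, L, S, L, R], [L, L, R, L, L, R], [L, L, S, L, L, S],
   [L, L, S, L, S, R], [L, L, S, R, L, R], [L, L, S, S, R, R], [L, R, L, R, L, R],
   [L, S, L, S, L, S], [L, S, L, S, S, R], [L, S, R, L, S, R], [L, S, S, L, S, S],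
   [L, S, S, S, R, S]]

theorem classReps_spec : ∀ l ∈ classReps, l.length = 6 ∧ idMonodromy l := by
  decide +kernel

theorem classReps_pairwise : classReps.Pairwise fun u v => ¬ wordEquiv u v := by
  decide +kernel

theorem exists_classReps_wordEquiv_of_letters :
    ∀ a b c d e f : Stone, idMonodromy [a, b, c, d, e, f] →
      ∃ u ∈ classReps, wordEquiv u [a, b, c, d, e, f] := by
  decide +kernel

theorem exists_classReps_wordEquiv {l : List Stone} (hl : l.length = 6) (h : idMonodromy l) :
    ∃ u ∈ classReps, wordEquiv u l := by
  match l, hl with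
  | [a, b, c, d, e, f], _ => exact exists_classReps_wordEquiv_of_letters a b c d e f h

theorem stmt14 :
    ∃ s : Setoid {l : List Stone // l.length = 6 ∧ idMonodromy l},
      (∀ a b, s.r a b ↔ wordEquiv a.1 b.1) ∧
      Nat.card (Quotient s) = 25 := by
  let s : Setoid {l : List Stone // l.length = 6 ∧ idMonodromy l} :=
    ⟨fun a b => wordEquiv a.1 b.1, wordEquiv_equivalence.comap Subtype.val⟩
  refine ⟨s, fun _ _ => Iff.rfl, ?_⟩
  let g : Fin classReps.length → Quotient s := fun i =>
    ⟦⟨classReps.get i, classReps_spec _ (List.get_mem _ i)⟩⟧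
  have hg : Function.Bijective g := by
    constructor
    · intro i j hij
      have h : wordEquiv (classReps.get i) (classReps.get j) := Quotient.exact hij
      have hp := List.pairwise_iff_get.1 classReps_pairwise
      rcases lt_trichotomy i j with hlt | heq | hgt
      · exact (hp i j hlt h).elim
      · exact heq
      · exact (hp j i hgt (wordEquiv_equivalence.symm h)).elim
    · intro q
      induction q using Quotient.inductionOn with
      | h l =>
        obtain ⟨u, hu, h⟩ := exists_classReps_wordEquiv l.2.1 l.2.2
        obtain ⟨i, rfl⟩ := List.mem_iff_get.1 hu
        exact ⟨i, Quotient.sound h⟩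
  rw [← Nat.card_eq_of_bijective g hg, Nat.card_fin]
  rfl
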